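/- Let A be an order-k real tensor with dimensions (d₁,…,d_k) and let π₁, π₂ be any two partitions of [k]. Then ‖Unfold_{π₁∧π₂}(A)‖_σ ≤ ‖Unfold_{π₁}(A)‖_σ ≤ [dim(A)/dim_A(π₁,π₂)]^{1/2} · ‖Unfold_{π₁∧π₂}(A)‖_σ. -/

import Mathlib

open scoped BigOperators ENNReal

namespace TensorUnfolding

/-- The vector `l^p` norm of a finitely-indexed real vector, for `p ∈ [1, ∞]`
(for `p = ∞` it is the maximum of the absolute values of the entries). -/
noncomputable def pNorm (p : ℝ≥0∞) {ι : Type} [Fintype ι] (x : ι → ℝ) : ℝ :=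
  if p = ⊤ then ⨆ i, |x i| else (∑ i, |x i| ^ p.toReal) ^ (1 / p.toReal)

/-- `π` is a partition of `[k] = {0, …, k-1}`: a collection of disjoint nonempty
blocks whose union is all of `Fin k`. -/
def IsPartition {k : ℕ} (π : Finset (Finset (Fin k))) : Prop :=
  (∀ B ∈ π, B.Nonempty) ∧
  (∀ B ∈ π, ∀ B' ∈ π, B ≠ B' → Disjoint B B') ∧
  π.sup id = Finset.univ

/-- `π₁ ≤ π₂`: every block of `π₁` is contained in some block of `π₂`. -/
def Refines {k : ℕ} (π₁ π₂ : Finset (Finset (Fin k))) : Prop :=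
  ∀ B ∈ π₁, ∃ B' ∈ π₂, B ⊆ B'

/-- The finest partition `0_{[k]} = {{1}, …, {k}}`. -/
def botPartition (k : ℕ) : Finset (Finset (Fin k)) :=
  Finset.univ.image fun n => {n}

/-- The coarsest (one-block) partition `1_{[k]} = {[k]}`. -/
def topPartition (k : ℕ) : Finset (Finset (Fin k)) :=
  {Finset.univ}

/-- The meet `π₁ ∧ π₂`: the partition whose blocks are the nonempty
intersections `B ∩ B'` with `B ∈ π₁`, `B' ∈ π₂`. -/
def meetPartition {k : ℕ} (π₁ π₂ : Finset (Finset (Fin k))) : Finset (Finset (Fin k)) :=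
  ((π₁ ×ˢ π₂).image fun p => p.1 ∩ p.2).filter fun B => B.Nonempty

/-- The `l^p` operator norm of the unfolding of the tensor `A` induced by the
partition `π`: the supremum of `⟨A, ⊗_{B ∈ π} y_B⟩` over choices, for each block
`B ∈ π`, of a vector `y_B` indexed by `Π_{j ∈ B} Fin (d j)` with `l^p` norm 1. -/
noncomputable def unfoldNormP {k : ℕ} (p : ℝ≥0∞) (d : Fin k → ℕ)
    (A : ((n : Fin k) → Fin (d n)) → ℝ) (π : Finset (Finset (Fin k))) : ℝ :=
  sSup { r : ℝ |
    ∃ y : (B : Finset (Fin k)) → ((j : B) → Fin (d j.1)) → ℝ,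
      (∀ B ∈ π, pNorm p (y B) = 1) ∧
      r = ∑ i : (n : Fin k) → Fin (d n), A i * ∏ B ∈ π, y B fun j => i j.1 }

/-- The spectral norm of the unfolding of the tensor `A` induced by the
partition `π`: the supremum of `⟨A, ⊗_{B ∈ π} y_B⟩` over choices, for each block
`B ∈ π`, of a vector `y_B` indexed by `Π_{j ∈ B} Fin (d j)` with Euclidean norm 1. -/
noncomputable def unfoldNorm {k : ℕ} (d : Fin k → ℕ)
    (A : ((n : Fin k) → Fin (d n)) → ℝ) (π : Finset (Finset (Fin k))) : ℝ :=
  sSup { r : ℝ |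
    ∃ y : (B : Finset (Fin k)) → ((j : B) → Fin (d j.1)) → ℝ,
      (∀ B ∈ π, ∑ v, (y B v) ^ 2 = 1) ∧
      r = ∑ i : (n : Fin k) → Fin (d n), A i * ∏ B ∈ π, y B fun j => i j.1 }

/-- The `l^p` operator norm of the tensor `A`:
`‖A‖_p = sup { A(x₁, …, x_k) : ‖x_n‖_p = 1 }`. -/
noncomputable def opNormP {k : ℕ} (p : ℝ≥0∞) (d : Fin k → ℕ)
    (A : ((n : Fin k) → Fin (d n)) → ℝ) : ℝ :=
  sSup { r : ℝ | ∃ x : (n : Fin k) → Fin (d n) → ℝ,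
    (∀ n, pNorm p (x n) = 1) ∧
    r = ∑ i : (n : Fin k) → Fin (d n), A i * ∏ n, x n (i n) }

/-- The spectral norm of the tensor `A`:
`‖A‖_σ = sup { A(x₁, …, x_k) : ‖x_n‖₂ = 1 }`. -/
noncomputable def specNorm {k : ℕ} (d : Fin k → ℕ)
    (A : ((n : Fin k) → Fin (d n)) → ℝ) : ℝ :=
  sSup { r : ℝ | ∃ x : (n : Fin k) → Fin (d n) → ℝ,
    (∀ n, ∑ i, (x n i) ^ 2 = 1) ∧
    r = ∑ i : (n : Fin k) → Fin (d n), A i * ∏ n, x n (i n) }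

/-- The Frobenius norm of the tensor `A`. -/
noncomputable def frobNorm {k : ℕ} (d : Fin k → ℕ)
    (A : ((n : Fin k) → Fin (d n)) → ℝ) : ℝ :=
  Real.sqrt (∑ i : (n : Fin k) → Fin (d n), (A i) ^ 2)

/-- `D_A(B, B') = Π_{n ∈ B ∩ B'} d_n` if `B ∩ B' ≠ ∅`, and `0` otherwise. -/
def blockDim {k : ℕ} (d : Fin k → ℕ) (B B' : Finset (Fin k)) : ℕ :=
  if (B ∩ B').Nonempty then ∏ n ∈ B ∩ B', d n else 0

/-- `dim_A(π₁, π₂) = Π_{B ∈ π₁} max_{B' ∈ π₂} D_A(B, B')`. -/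
def dimRel {k : ℕ} (d : Fin k → ℕ) (π₁ π₂ : Finset (Finset (Fin k))) : ℕ :=
  ∏ B ∈ π₁, π₂.sup fun B' => blockDim d B B'

/-- `A` is `π`-orthogonal decomposable: `A = Σ_{n=1}^r λ_n a₁⁽ⁿ⁾ ⊗ ⋯ ⊗ a_k⁽ⁿ⁾`
with `λ₁ ≥ ⋯ ≥ λ_r ≥ 0` and `Π_{i ∈ B} ⟨a_i⁽ⁿ⁾, a_i⁽ᵐ⁾⟩ = δ_{nm}` for every
block `B ∈ π`. -/
def IsPiOD {k : ℕ} (d : Fin k → ℕ) (A : ((n : Fin k) → Fin (d n)) → ℝ)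
    (π : Finset (Finset (Fin k))) : Prop :=
  ∃ (r : ℕ) (lam : Fin r → ℝ) (a : Fin r → (n : Fin k) → Fin (d n) → ℝ),
    Antitone lam ∧ (∀ n, 0 ≤ lam n) ∧
    (∀ i, A i = ∑ n, lam n * ∏ m, a n m (i m)) ∧
    (∀ B ∈ π, ∀ n m : Fin r,
      (∏ j ∈ B, ∑ t, a n j t * a m j t) = if n = m then 1 else 0)

end TensorUnfolding

namespace TensorUnfolding

variable {k : ℕ} {d : Fin k → ℕ}

theorem IsPartition.exists_mem {π : Finset (Finset (Fin k))} (h : IsPartition π) (n : Fin k) :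
    ∃ B ∈ π, n ∈ B := by
  have hn : n ∈ π.sup id := by rw [h.2.2]; exact Finset.mem_univ n
  simpa [Finset.mem_sup] using hn

theorem IsPartition.eq_of_mem {π : Finset (Finset (Fin k))} (h : IsPartition π)
    {B B' : Finset (Fin k)} (hB : B ∈ π) (hB' : B' ∈ π) {n : Fin k} (hn : n ∈ B) (hn' : n ∈ B') :
    B = B' := by
  by_contra hne
  exact Finset.disjoint_left.mp (h.2.1 B hB B' hB' hne) hn hn'

/-- Sums of products of functions of the restrictions to the blocks factor over a partition. -/
theorem IsPartition.sum_prod_restrict {π : Finset (Finset (Fin k))} (h : IsPartition π)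
    (f : (B : Finset (Fin k)) → ((j : B) → Fin (d j.1)) → ℝ) :
    ∑ i : (n : Fin k) → Fin (d n), ∏ B ∈ π, f B (fun j => i j.1) = ∏ B ∈ π, ∑ v, f B v := by
  classical
  rw [← Finset.prod_coe_sort π (fun B => ∑ v, f B v), Finset.prod_univ_sum,
    Fintype.piFinset_univ]
  refine Fintype.sum_bijective
    (fun (i : (n : Fin k) → Fin (d n)) (B : π) (j : B.1) => i j.1) ⟨?_, ?_⟩ _ _ ?_
  · intro i i' hii
    funext n
    obtain ⟨B, hB, hn⟩ := h.exists_mem n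
    exact congrFun (congrFun hii ⟨B, hB⟩) ⟨n, hn⟩
  · intro p
    choose b hb hnb using h.exists_mem
    refine ⟨fun n => p ⟨b n, hb n⟩ ⟨n, hnb n⟩, ?_⟩
    funext ⟨B, hB⟩ ⟨n, hn⟩
    obtain rfl := h.eq_of_mem hB (hb n) hn (hnb n)
    rfl
  · intro i
    exact (Finset.prod_coe_sort π (fun B => f B (fun j => i j.1))).symm

/-- The value of the multilinear form of the unfolding of `A` at the vectors `y_B`. -/
noncomputable def unfoldForm (A : ((n : Fin k) → Fin (d n)) → ℝ) (π : Finset (Finset (Fin k)))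
    (y : (B : Finset (Fin k)) → ((j : B) → Fin (d j.1)) → ℝ) : ℝ :=
  ∑ i : (n : Fin k) → Fin (d n), A i * ∏ B ∈ π, y B fun j => i j.1

theorem unfoldForm_le_unfoldNorm (A : ((n : Fin k) → Fin (d n)) → ℝ)
    (π : Finset (Finset (Fin k))) (y : (B : Finset (Fin k)) → ((j : B) → Fin (d j.1)) → ℝ)
    (hy : ∀ B ∈ π, ∑ v, (y B v) ^ 2 = 1) : unfoldForm A π y ≤ unfoldNorm d A π := by
  refine le_csSup ⟨∑ i, |A i|, ?_⟩ ⟨y, hy, rfl⟩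
  rintro r ⟨y, hy, rfl⟩
  refine Finset.sum_le_sum fun i _ => (le_abs_self _).trans ?_
  rw [abs_mul, Finset.abs_prod]
  refine mul_le_of_le_one_right (abs_nonneg _)
    (Finset.prod_le_one (fun _ _ => abs_nonneg _) fun B hB => ?_)
  rw [← sq_le_one_iff_abs_le_one, ← hy B hB]
  exact Finset.single_le_sum (f := fun v => (y B v) ^ 2) (fun _ _ => sq_nonneg _)
    (Finset.mem_univ _)

theorem unfoldForm_le (A : ((n : Fin k) → Fin (d n)) → ℝ)
    (π : Finset (Finset (Fin k))) (y : (B : Finset (Fin k)) → ((j : B) → Fin (d j.1)) → ℝ) :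
    unfoldForm A π y ≤ unfoldNorm d A π * ∏ B ∈ π, √(∑ v, (y B v) ^ 2) := by
  by_cases h0 : ∃ B ∈ π, ∑ v, (y B v) ^ 2 = 0
  · obtain ⟨B, hB, h⟩ := h0
    have hy : ∀ v, y B v = 0 := by
      intro v
      have := (Finset.sum_eq_zero_iff_of_nonneg (fun v _ => sq_nonneg (y B v))).mp h v
        (Finset.mem_univ _)
      simpa using this
    rw [Finset.prod_eq_zero hB (by rw [h, Real.sqrt_zero]), mul_zero]
    refine (Finset.sum_eq_zero fun i _ => ?_).le
    rw [Finset.prod_eq_zero hB (hy _), mul_zero]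
  · push Not at h0
    have hpos : ∀ B ∈ π, 0 < √(∑ v, (y B v) ^ 2) := fun B hB =>
      Real.sqrt_pos.mpr ((Finset.sum_nonneg fun _ _ => sq_nonneg _).lt_of_ne' (h0 B hB))
    have hP : 0 < ∏ B ∈ π, √(∑ v, (y B v) ^ 2) := Finset.prod_pos hpos
    have key := unfoldForm_le_unfoldNorm A π (fun B v => y B v / √(∑ v, (y B v) ^ 2)) (by
      intro B hB
      simp_rw [div_pow]
      rw [← Finset.sum_div, Real.sq_sqrt (Finset.sum_nonneg fun _ _ => sq_nonneg _),
        div_self (h0 B hB)])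
    refine le_trans (le_of_eq ?_) (mul_le_mul_of_nonneg_right key hP.le)
    simp only [unfoldForm, Finset.sum_mul, Finset.prod_div_distrib]
    refine Finset.sum_congr rfl fun i _ => ?_
    rw [mul_assoc, div_mul_cancel₀ _ hP.ne']

theorem exists_unit_family (hd : ∀ n, 1 ≤ d n) :
    ∃ y : (B : Finset (Fin k)) → ((j : B) → Fin (d j.1)) → ℝ, ∀ B, ∑ v, (y B v) ^ 2 = 1 := by
  classical
  refine ⟨fun B v => if v = (fun j => ⟨0, hd j.1⟩) then 1 else 0, fun B => ?_⟩
  simp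

theorem unfoldNorm_le (hd : ∀ n, 1 ≤ d n) {A : ((n : Fin k) → Fin (d n)) → ℝ}
    {π : Finset (Finset (Fin k))} {M : ℝ}
    (h : ∀ y : (B : Finset (Fin k)) → ((j : B) → Fin (d j.1)) → ℝ,
      (∀ B ∈ π, ∑ v, (y B v) ^ 2 = 1) → unfoldForm A π y ≤ M) : unfoldNorm d A π ≤ M := by
  obtain ⟨y, hy⟩ := exists_unit_family hd
  refine csSup_le ⟨_, y, fun B _ => hy B, rfl⟩ ?_
  rintro r ⟨y, hy, rfl⟩
  exact h y hy

theorem unfoldNorm_nonneg (hd : ∀ n, 1 ≤ d n) (A : ((n : Fin k) → Fin (d n)) → ℝ)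
    {π : Finset (Finset (Fin k))} (hπ : π.Nonempty) : 0 ≤ unfoldNorm d A π := by
  classical
  obtain ⟨y, hy⟩ := exists_unit_family hd
  obtain ⟨B₀, hB₀⟩ := hπ
  have h1 := unfoldForm_le_unfoldNorm A π y fun B _ => hy B
  have h2 := unfoldForm_le_unfoldNorm A π (fun B v => (if B = B₀ then -1 else 1) * y B v) (by
    intro B _
    refine (Finset.sum_congr rfl fun v _ => ?_).trans (hy B)
    split_ifs <;> ring)
  have h3 : unfoldForm A π (fun B v => (if B = B₀ then -1 else 1) * y B v) =
      -unfoldForm A π y := by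
    simp only [unfoldForm, Finset.prod_mul_distrib, Finset.prod_ite_eq', hB₀, if_true,
      ← Finset.sum_neg_distrib]
    refine Finset.sum_congr rfl fun i _ => ?_
    ring
  linarith

theorem Refines.exists_parent {σ π : Finset (Finset (Fin k))}
    (hπ : IsPartition π) (h : Refines σ π) :
    ∃ par : Finset (Fin k) → Finset (Fin k),
      ∀ C ∈ σ, par C ∈ π ∧ C ⊆ par C ∧ ∀ B ∈ π, ∀ n ∈ C, n ∈ B → par C = B := by
  classical
  refine ⟨fun C => if hC : C ∈ σ then (h C hC).choose else ∅, fun C hC => ?_⟩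
  obtain ⟨h1, h2⟩ := (h C hC).choose_spec
  simp only [hC, dif_pos]
  exact ⟨h1, h2, fun B hB n hn hnB => hπ.eq_of_mem h1 hB (h2 hn) hnB⟩

/-- Refining the partition does not increase the spectral norm of the unfolding. -/
theorem unfoldNorm_mono (hd : ∀ n, 1 ≤ d n) (A : ((n : Fin k) → Fin (d n)) → ℝ)
    {σ π : Finset (Finset (Fin k))} (hσ : IsPartition σ) (hπ : IsPartition π)
    (h : Refines σ π) : unfoldNorm d A σ ≤ unfoldNorm d A π := by
  classical
  obtain ⟨par, hpar⟩ := h.exists_parent hπ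
  refine unfoldNorm_le hd fun y hy => ?_
  let ext (B : Finset (Fin k)) (v : (j : B) → Fin (d j.1)) (n : Fin k) : Fin (d n) :=
    if hn : n ∈ B then v ⟨n, hn⟩ else ⟨0, hd n⟩
  let z (B : Finset (Fin k)) (v : (j : B) → Fin (d j.1)) : ℝ :=
    ∏ C ∈ σ with par C = B, y C fun j => ext B v j.1
  have hz (i : (n : Fin k) → Fin (d n)) :
      ∏ B ∈ π, z B (fun j => i j.1) = ∏ C ∈ σ, y C fun j => i j.1 := by
    rw [← Finset.prod_fiberwise_of_maps_to (fun C hC => (hpar C hC).1)]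
    refine Finset.prod_congr rfl fun B _ => Finset.prod_congr rfl fun C hC => ?_
    obtain ⟨hCσ, rfl⟩ := Finset.mem_filter.mp hC
    congr 1
    funext j
    exact dif_pos ((hpar C hCσ).2.1 j.2)
  have hnorm : ∏ B ∈ π, ∑ v, (z B v) ^ 2 = 1 := by
    rw [← hπ.sum_prod_restrict fun B v => (z B v) ^ 2]
    simp only [Finset.prod_pow, hz]
    simp only [← Finset.prod_pow]
    rw [hσ.sum_prod_restrict fun C v => (y C v) ^ 2]
    exact Finset.prod_eq_one hy
  have key := unfoldForm_le A π z
  rw [← Real.sqrt_prod _ fun _ _ => Finset.sum_nonneg fun _ _ => sq_nonneg _, hnorm,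
    Real.sqrt_one, mul_one] at key
  simpa only [unfoldForm, hz] using key

/-- The multi-index on `B` with entries `w` on `C` and `v` elsewhere. -/
def mergeIndex {B : Finset (Fin k)} (C : Finset (Fin k)) (w : (j : C) → Fin (d j.1))
    (v : (j : B) → Fin (d j.1)) (j : B) : Fin (d j.1) :=
  if h : j.1 ∈ C then w ⟨j.1, h⟩ else v j

open Classical in
theorem sum_mergeIndex {B C : Finset (Fin k)} (hCB : C ⊆ B) (v : (j : B) → Fin (d j.1))
    (F : ((j : B) → Fin (d j.1)) → ℝ) :
    ∑ w : (j : C) → Fin (d j.1), F (mergeIndex C w v) =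
      ∑ v', if ∀ j : B, j.1 ∉ C → v' j = v j then F v' else 0 := by
  rw [← Finset.sum_filter]
  refine Finset.sum_nbij' (fun w => mergeIndex C w v) (fun v' j => v' ⟨j.1, hCB j.2⟩)
    ?_ ?_ ?_ ?_ ?_
  · intro w _
    simp +contextual [mergeIndex]
  · simp
  · intro w _
    funext j
    simp [mergeIndex]
  · intro v' hv'
    funext j
    by_cases hj : j.1 ∈ C
    · simp [mergeIndex, hj]
    · simp only [mergeIndex, hj, dif_neg, not_false_iff]
      exact ((Finset.mem_filter.mp hv').2 j hj).symm
  · simp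

open Classical in
theorem sum_ite_eq_off {B C : Finset (Fin k)} (hCB : C ⊆ B) (v : (j : B) → Fin (d j.1)) (a : ℝ) :
    (∑ v' : (j : B) → Fin (d j.1), if ∀ j : B, j.1 ∉ C → v' j = v j then a else 0) =
      (∏ n ∈ C, (d n : ℝ)) * a := by
  rw [← sum_mergeIndex hCB v fun _ => a]
  simp [Finset.prod_attach C fun n => (d n : ℝ)]

theorem sum_sum_mergeIndex {B C : Finset (Fin k)} (hCB : C ⊆ B)
    (F : ((j : B) → Fin (d j.1)) → ℝ) :
    ∑ v : (j : B) → Fin (d j.1), ∑ w : (j : C) → Fin (d j.1), F (mergeIndex C w v) =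
      (∏ n ∈ C, (d n : ℝ)) * ∑ v, F v := by
  classical
  simp only [sum_mergeIndex hCB]
  rw [Finset.sum_comm, Finset.mul_sum]
  refine Finset.sum_congr rfl fun v _ => ?_
  rw [← sum_ite_eq_off hCB v]
  simp only [eq_comm]

/-- If `σ` refines `π` and `c` selects a block of `σ` inside each block of `π`, then the spectral
norm of the `π`-unfolding is controlled by that of the `σ`-unfolding, with a constant given by the
dimensions outside of the selected blocks. -/
theorem unfoldForm_le_of_refines (hd : ∀ n, 1 ≤ d n) (A : ((n : Fin k) → Fin (d n)) → ℝ)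
    {σ π : Finset (Finset (Fin k))} (hσ : IsPartition σ) (hπ : IsPartition π)
    (h : Refines σ π) (hne : σ.Nonempty) (c : Finset (Fin k) → Finset (Fin k))
    (hc : ∀ B ∈ π, c B ∈ σ ∧ c B ⊆ B)
    (y : (B : Finset (Fin k)) → ((j : B) → Fin (d j.1)) → ℝ)
    (hy : ∀ B ∈ π, ∑ v, (y B v) ^ 2 = 1) :
    (∏ B ∈ π, ∏ n ∈ c B, (d n : ℝ)) * unfoldForm A π y ≤
      unfoldNorm d A σ * √((∏ n, (d n : ℝ)) * ∏ B ∈ π, ∏ n ∈ c B, (d n : ℝ)) := by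
  classical
  obtain ⟨par, hpar⟩ := h.exists_parent hπ
  have hparc : ∀ B ∈ π, par (c B) = B := fun B hB => by
    obtain ⟨n, hn⟩ := hσ.1 _ (hc B hB).1
    exact (hpar _ (hc B hB).1).2.2 B hB n hn ((hc B hB).2 hn)
  have hmem : ∀ B ∈ π, c B ∈ σ.filter fun C => par C = B := fun B hB =>
    Finset.mem_filter.mpr ⟨(hc B hB).1, hparc B hB⟩
  let z (u : (n : Fin k) → Fin (d n)) (C : Finset (Fin k)) (w : (j : C) → Fin (d j.1)) : ℝ :=
    if C = c (par C) then y (par C) (mergeIndex C w fun j => u j.1)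
    else if ∀ j : C, w j = u j.1 then 1 else 0
  have hz_sel (u) (B) (hB : B ∈ π) (w) :
      z u (c B) w = y B (mergeIndex (c B) w fun j => u j.1) := by
    simp only [z]
    rw [hparc B hB, if_pos rfl]
  have hz_other (u) (B) (C) (hC : C ∈ (σ.filter fun C => par C = B).erase (c B)) (w) :
      z u C w = if ∀ j : C, w j = u j.1 then 1 else 0 := by
    obtain ⟨hCne, hC⟩ := Finset.mem_erase.mp hC
    obtain ⟨hCσ, rfl⟩ := Finset.mem_filter.mp hC
    exact if_neg hCne
  have hprod (u i : (n : Fin k) → Fin (d n)) :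
      ∏ C ∈ σ, z u C (fun j => i j.1) =
        ∏ B ∈ π, if ∀ j : B, j.1 ∉ c B → u j.1 = i j.1 then y B (fun j => i j.1) else 0 := by
    rw [← Finset.prod_fiberwise_of_maps_to (fun C hC => (hpar C hC).1)]
    refine Finset.prod_congr rfl fun B hB => ?_
    rw [← Finset.mul_prod_erase _ _ (hmem B hB),
      Finset.prod_congr rfl fun C hC => hz_other u B C hC _, Finset.prod_ite_zero, hz_sel u B hB]
    have hiff : (∀ C ∈ (σ.filter fun C => par C = B).erase (c B), ∀ j : C, i j.1 = u j.1) ↔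
        ∀ j : B, j.1 ∉ c B → u j.1 = i j.1 := by
      constructor
      · intro H j hj
        obtain ⟨C, hC, hjC⟩ := hσ.exists_mem j.1
        refine (H C (Finset.mem_erase.mpr ⟨?_, Finset.mem_filter.mpr
          ⟨hC, (hpar C hC).2.2 B hB _ hjC j.2⟩⟩) ⟨j.1, hjC⟩).symm
        rintro rfl
        exact hj hjC
      · intro H C hC j
        obtain ⟨hCne, hC⟩ := Finset.mem_erase.mp hC
        obtain ⟨hCσ, rfl⟩ := Finset.mem_filter.mp hC
        refine (H ⟨j.1, (hpar C hCσ).2.1 j.2⟩ fun hj => ?_).symm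
        exact hCne (hσ.eq_of_mem hCσ (hc _ hB).1 j.2 hj)
    by_cases H : ∀ j : B, j.1 ∉ c B → u j.1 = i j.1
    · rw [if_pos H, if_pos (hiff.mpr H), Finset.prod_const_one, mul_one]
      congr 1
      funext j
      by_cases hj : j.1 ∈ c B
      · simp [mergeIndex, hj]
      · simp [mergeIndex, hj, H j hj]
    · rw [if_neg H, if_neg (mt hiff.mp H), mul_zero]
  have hsum (i : (n : Fin k) → Fin (d n)) :
      ∑ u, ∏ C ∈ σ, z u C (fun j => i j.1) =
        (∏ B ∈ π, ∏ n ∈ c B, (d n : ℝ)) * ∏ B ∈ π, y B fun j => i j.1 := by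
    simp only [hprod]
    rw [hπ.sum_prod_restrict fun B v =>
      if ∀ j : B, j.1 ∉ c B → v j = i j.1 then y B (fun j => i j.1) else 0,
      ← Finset.prod_mul_distrib]
    exact Finset.prod_congr rfl fun B hB => sum_ite_eq_off (hc B hB).2 (fun j => i j.1) _
  have hnorm (u : (n : Fin k) → Fin (d n)) :
      ∏ C ∈ σ, ∑ w, (z u C w) ^ 2 =
        ∏ B ∈ π, ∑ w, (y B (mergeIndex (c B) w fun j => u j.1)) ^ 2 := by
    rw [← Finset.prod_fiberwise_of_maps_to (fun C hC => (hpar C hC).1)]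
    refine Finset.prod_congr rfl fun B hB => ?_
    rw [← Finset.mul_prod_erase _ _ (hmem B hB), Finset.prod_eq_one, mul_one]
    · simp only [hz_sel u B hB]
    · intro C hC
      simp only [hz_other u B C hC, ← funext_iff, ite_pow, one_pow, ne_eq, OfNat.ofNat_ne_zero,
        not_false_eq_true, zero_pow]
      exact (Finset.sum_ite_eq' _ _ _).trans (if_pos (Finset.mem_univ _))
  have hnormsum : ∑ u, ∏ C ∈ σ, ∑ w, (z u C w) ^ 2 = ∏ B ∈ π, ∏ n ∈ c B, (d n : ℝ) := by
    simp only [hnorm]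
    rw [hπ.sum_prod_restrict fun B v => ∑ w, (y B (mergeIndex (c B) w v)) ^ 2]
    refine Finset.prod_congr rfl fun B hB => ?_
    rw [sum_sum_mergeIndex (hc B hB).2 fun v => (y B v) ^ 2, hy B hB, mul_one]
  have hnn (u) : 0 ≤ ∏ C ∈ σ, ∑ w, (z u C w) ^ 2 :=
    Finset.prod_nonneg fun _ _ => Finset.sum_nonneg fun _ _ => sq_nonneg _
  calc (∏ B ∈ π, ∏ n ∈ c B, (d n : ℝ)) * unfoldForm A π y
      = ∑ u, unfoldForm A σ (z u) := by
        simp only [unfoldForm]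
        rw [Finset.sum_comm, Finset.mul_sum]
        refine Finset.sum_congr rfl fun i _ => ?_
        rw [← Finset.mul_sum, hsum]
        ring
    _ ≤ ∑ u, unfoldNorm d A σ * √(∏ C ∈ σ, ∑ w, (z u C w) ^ 2) := by
        refine Finset.sum_le_sum fun u _ => (unfoldForm_le A σ (z u)).trans_eq ?_
        rw [Real.sqrt_prod _ fun _ _ => Finset.sum_nonneg fun _ _ => sq_nonneg _]
    _ = unfoldNorm d A σ * ∑ u, √(∏ C ∈ σ, ∑ w, (z u C w) ^ 2) := by rw [Finset.mul_sum]
    _ ≤ _ := by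
        refine mul_le_mul_of_nonneg_left (Real.le_sqrt_of_sq_le ?_) (unfoldNorm_nonneg hd A hne)
        refine sq_sum_le_card_mul_sum_sq.trans_eq ?_
        simp only [Real.sq_sqrt (hnn _), hnormsum]
        simp

theorem mem_meetPartition {π₁ π₂ : Finset (Finset (Fin k))} {C : Finset (Fin k)} :
    C ∈ meetPartition π₁ π₂ ↔ (∃ B ∈ π₁, ∃ B' ∈ π₂, B ∩ B' = C) ∧ C.Nonempty := by
  simp [meetPartition, and_assoc]

theorem IsPartition.meet {π₁ π₂ : Finset (Finset (Fin k))} (h₁ : IsPartition π₁)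
    (h₂ : IsPartition π₂) : IsPartition (meetPartition π₁ π₂) := by
  refine ⟨fun B hB => (mem_meetPartition.mp hB).2, ?_, ?_⟩
  · intro C hC D hD hne
    obtain ⟨⟨B, hB, B', hB', rfl⟩, -⟩ := mem_meetPartition.mp hC
    obtain ⟨⟨E, hE, E', hE', rfl⟩, -⟩ := mem_meetPartition.mp hD
    refine Finset.disjoint_left.mpr fun n hn hn' => hne ?_
    rw [Finset.mem_inter] at hn hn'
    rw [h₁.eq_of_mem hB hE hn.1 hn'.1, h₂.eq_of_mem hB' hE' hn.2 hn'.2]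
  · refine Finset.eq_univ_of_forall fun n => Finset.mem_sup.mpr ?_
    obtain ⟨B, hB, hn⟩ := h₁.exists_mem n
    obtain ⟨B', hB', hn'⟩ := h₂.exists_mem n
    have hmem := Finset.mem_inter.mpr ⟨hn, hn'⟩
    exact ⟨B ∩ B', mem_meetPartition.mpr ⟨⟨B, hB, B', hB', rfl⟩, n, hmem⟩, hmem⟩

theorem meetPartition_refines_left (π₁ π₂ : Finset (Finset (Fin k))) :
    Refines (meetPartition π₁ π₂) π₁ := by
  intro C hC
  obtain ⟨⟨B, hB, B', -, rfl⟩, -⟩ := mem_meetPartition.mp hC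
  exact ⟨B, hB, Finset.inter_subset_left⟩

theorem exists_maximal_block (hd : ∀ n, 1 ≤ d n) {π₁ π₂ : Finset (Finset (Fin k))}
    (h₁ : IsPartition π₁) (h₂ : IsPartition π₂) {B : Finset (Fin k)} (hB : B ∈ π₁) :
    ∃ C ∈ meetPartition π₁ π₂, C ⊆ B ∧ π₂.sup (fun B' => blockDim d B B') = ∏ n ∈ C, d n := by
  obtain ⟨n, hn⟩ := h₁.1 B hB
  obtain ⟨E, hE, hnE⟩ := h₂.exists_mem n
  obtain ⟨B', hB', hsup⟩ := Finset.exists_mem_eq_sup π₂ ⟨E, hE⟩ (fun B' => blockDim d B B')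
  have hpos : 0 < blockDim d B E := by
    rw [blockDim, if_pos ⟨n, Finset.mem_inter.mpr ⟨hn, hnE⟩⟩]
    exact Finset.prod_pos fun m _ => hd m
  have hpos' : 0 < blockDim d B B' := by
    rw [← hsup]
    exact hpos.trans_le (Finset.le_sup (f := fun B' => blockDim d B B') hE)
  have hne : (B ∩ B').Nonempty := by
    by_contra hne
    rw [blockDim, if_neg hne] at hpos'
    exact hpos'.false
  refine ⟨B ∩ B', mem_meetPartition.mpr ⟨⟨B, hB, B', hB', rfl⟩, hne⟩,
    Finset.inter_subset_left, ?_⟩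
  rw [hsup, blockDim, if_pos hne]

end TensorUnfolding

open TensorUnfolding in
/-- For any two partitions `π₁, π₂` of `[k]`,
`‖Unfold_{π₁∧π₂}(A)‖_σ ≤ ‖Unfold_{π₁}(A)‖_σ ≤
 [dim(A)/dim_A(π₁,π₂)]^{1/2} ‖Unfold_{π₁∧π₂}(A)‖_σ`. -/
theorem meet_sandwich {k : ℕ} (d : Fin k → ℕ) (hd : ∀ n, 1 ≤ d n)
    (A : ((n : Fin k) → Fin (d n)) → ℝ)
    (π₁ π₂ : Finset (Finset (Fin k)))
    (h₁ : IsPartition π₁) (h₂ : IsPartition π₂) :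
    unfoldNorm d A (meetPartition π₁ π₂) ≤ unfoldNorm d A π₁ ∧
    unfoldNorm d A π₁ ≤
      ((∏ n : Fin k, (d n : ℝ)) / (dimRel d π₁ π₂ : ℝ)) ^ ((1 : ℝ) / 2) *
        unfoldNorm d A (meetPartition π₁ π₂) := by
  have hmeet := h₁.meet h₂
  have href := meetPartition_refines_left π₁ π₂
  refine ⟨unfoldNorm_mono hd A hmeet h₁ href, ?_⟩
  rcases π₁.eq_empty_or_nonempty with rfl | ⟨B₀, hB₀⟩
  · have huniv : (Finset.univ : Finset (Fin k)) = ∅ := h₁.2.2.symm.trans Finset.sup_empty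
    simp [meetPartition, dimRel, huniv]
  have hchoice : ∀ B : Finset (Fin k), ∃ C, B ∈ π₁ → C ∈ meetPartition π₁ π₂ ∧ C ⊆ B ∧
      π₂.sup (fun B' => blockDim d B B') = ∏ n ∈ C, d n := fun B => by
    by_cases hB : B ∈ π₁
    · obtain ⟨C, hC⟩ := exists_maximal_block hd h₁ h₂ hB
      exact ⟨C, fun _ => hC⟩
    · exact ⟨∅, fun h => absurd h hB⟩
  choose c hc using hchoice
  have hdim : (dimRel d π₁ π₂ : ℝ) = ∏ B ∈ π₁, ∏ n ∈ c B, (d n : ℝ) := by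
    rw [dimRel, Finset.prod_congr rfl fun B hB => (hc B hB).2.2]
    push_cast
    rfl
  have hpos : (0 : ℝ) < dimRel d π₁ π₂ := by
    rw [hdim]
    exact Finset.prod_pos fun B _ => Finset.prod_pos fun n _ => Nat.cast_pos.mpr (hd n)
  refine unfoldNorm_le hd fun y hy => ?_
  have key := unfoldForm_le_of_refines hd A hmeet h₁ href ⟨c B₀, (hc B₀ hB₀).1⟩ c
    (fun B hB => ⟨(hc B hB).1, (hc B hB).2.1⟩) y hy
  rw [← hdim] at key
  rw [← Real.sqrt_eq_rpow]
  refine le_of_mul_le_mul_left (key.trans_eq ?_) hpos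
  have hsqrt : √((∏ n, (d n : ℝ)) * dimRel d π₁ π₂) =
      dimRel d π₁ π₂ * √((∏ n, (d n : ℝ)) / dimRel d π₁ π₂) := by
    rw [← Real.sqrt_sq hpos.le, ← Real.sqrt_mul (sq_nonneg _), Real.sqrt_sq hpos.le]
    congr 1
    field_simp
  rw [hsqrt]
  ring
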